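/- For all integers n, i, k satisfying n ≥ i ≥ k ≥ 0 and k ≤ (n−i)/2, if n and i have the same parity then the number of Jacobi permutations of [n] avoiding 123 with exactly i left-to-right minima and exactly k ascents equals (1/(n+1))·C(n+1, k)·C(n+1−k, i−k)·C((n−i)/2 − 1, k−1); if n and i have opposite parity this count is 0. (Here C(a,b) = 0 whenever b < 0 or b > a, with the convention C(−1, −1) = 1 for the case k = 0.) -/

import Mathlib

/-- The length of `ρ_π(π_k)`: the maximal consecutive subword of `π` immediately to the
right of position `k`, all of whose letters are larger than `π_k`.  Letters of a
permutation of `[n] = {1,…,n}` are modelled by `(π i : ℕ) + 1` for `π : Equiv.Perm (Fin n)`. -/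
noncomputable def rhoLen {n : ℕ} (π : Equiv.Perm (Fin n)) (k : Fin n) : ℕ :=
  Nat.card {j : Fin n // k < j ∧ ∀ i : Fin n, k < i → i ≤ j → π k < π i}

/-- A permutation is Jacobi if `ρ_π(π_k)` has even length for every position `k`. -/
def IsJacobi {n : ℕ} (π : Equiv.Perm (Fin n)) : Prop :=
  ∀ k : Fin n, Even (rhoLen π k)

/-- `π` avoids the pattern `123`. -/
def Avoids123 {n : ℕ} (π : Equiv.Perm (Fin n)) : Prop :=
  ¬ ∃ i j k : Fin n, i < j ∧ j < k ∧ π i < π j ∧ π j < π k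

/-- `π` avoids the pattern `132`. -/
def Avoids132 {n : ℕ} (π : Equiv.Perm (Fin n)) : Prop :=
  ¬ ∃ i j k : Fin n, i < j ∧ j < k ∧ π i < π k ∧ π k < π j

/-- `π` avoids the pattern `213`. -/
def Avoids213 {n : ℕ} (π : Equiv.Perm (Fin n)) : Prop :=
  ¬ ∃ i j k : Fin n, i < j ∧ j < k ∧ π j < π i ∧ π i < π k

/-- `π` avoids the pattern `231`. -/
def Avoids231 {n : ℕ} (π : Equiv.Perm (Fin n)) : Prop :=
  ¬ ∃ i j k : Fin n, i < j ∧ j < k ∧ π k < π i ∧ π i < π j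

/-- `π` avoids the pattern `312`. -/
def Avoids312 {n : ℕ} (π : Equiv.Perm (Fin n)) : Prop :=
  ¬ ∃ i j k : Fin n, i < j ∧ j < k ∧ π j < π k ∧ π k < π i

/-- `π` avoids the pattern `321`. -/
def Avoids321 {n : ℕ} (π : Equiv.Perm (Fin n)) : Prop :=
  ¬ ∃ i j k : Fin n, i < j ∧ j < k ∧ π k < π j ∧ π j < π i

/-- The number of ascents of `π`. -/
noncomputable def ascCount {n : ℕ} (π : Equiv.Perm (Fin n)) : ℕ :=
  Nat.card {k : Fin n // ∃ h : (k : ℕ) + 1 < n, π k < π ⟨(k : ℕ) + 1, h⟩}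

/-- The number of left-to-right minima of `π`. -/
noncomputable def lrminCount {n : ℕ} (π : Equiv.Perm (Fin n)) : ℕ :=
  Nat.card {k : Fin n // ∀ i : Fin n, i < k → π k < π i}

/-- The binomial coefficient `C(a,b)` for integers, with `C(a,b) = 0` whenever `b < 0` or
`b > a`, except for the convention `C(-1,-1) = 1`. -/
def chooseConv (a b : ℤ) : ℤ :=
  if a = -1 ∧ b = -1 then 1
  else if 0 ≤ b ∧ b ≤ a then (a.toNat.choose b.toNat : ℤ) else 0


/-- ballot condition on a word of length `n+1` -/
def JGood (n : ℕ) (x : Fin (n+1) → ℕ) : Prop :=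
  ∀ t, t ≤ n → ∑ s ∈ Finset.range (t+1), x (Fin.ofNat (n+1) s) ≤ t

/-- cyclic rotation -/
def jrot {n : ℕ} (r : Fin (n+1)) (x : Fin (n+1) → ℕ) : Fin (n+1) → ℕ := fun j => x (j + r)

lemma jofNat_add {n : ℕ} (s : ℕ) (r : Fin (n+1)) :
    Fin.ofNat (n+1) s + r = Fin.ofNat (n+1) (r.val + s) := by
  apply Fin.ext
  simp [Fin.val_add, Nat.add_comm]

lemma jsum_range {n : ℕ} (x : Fin (n+1) → ℕ) :
    ∑ s ∈ Finset.range (n+1), x (Fin.ofNat (n+1) s) = ∑ j, x j := by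
  rw [Finset.sum_range]
  apply Finset.sum_congr rfl
  intro j _
  congr 1
  apply Fin.ext
  simp

/-- partial sums -/
def jY {n : ℕ} (x : Fin (n+1) → ℕ) (t : ℕ) : ℕ :=
  ∑ s ∈ Finset.range t, x (Fin.ofNat (n+1) s)

lemma jY_add {n : ℕ} (x : Fin (n+1) → ℕ) (r t : ℕ) :
    jY x (r + t) = jY x r + ∑ s ∈ Finset.range t, x (Fin.ofNat (n+1) (r + s)) := by
  unfold jY
  rw [Finset.sum_range_add]

lemma jY_period {n : ℕ} (x : Fin (n+1) → ℕ) (hx : ∑ j, x j = n) (t : ℕ) :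
    jY x (t + (n+1)) = jY x t + n := by
  rw [Nat.add_comm, jY_add]
  have h1 : jY x (n+1) = n := by unfold jY; rw [jsum_range, hx]
  rw [h1, Nat.add_comm]
  congr 1
  unfold jY
  apply Finset.sum_congr rfl
  intro s _
  congr 1
  apply Fin.ext
  simp

lemma jgood_rot_iff {n : ℕ} (x : Fin (n+1) → ℕ) (r : Fin (n+1)) :
    JGood n (jrot r x) ↔ ∀ t, t ≤ n → jY x (r.val + (t+1)) ≤ jY x r.val + t := by
  unfold JGood
  apply forall_congr'; intro t
  apply imp_congr_right; intro _
  rw [jY_add]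
  simp only [jrot, jofNat_add]
  omega

lemma jexists_unique_rot {n : ℕ} (x : Fin (n+1) → ℕ) (hx : ∑ j, x j = n) :
    ∃! r : Fin (n+1), JGood n (jrot r x) := by
  let g : ℕ → ℤ := fun t => (t : ℤ) - jY x t
  have hper : ∀ t, g (t + (n+1)) = g t + 1 := by
    intro t
    simp only [g]
    rw [jY_period x hx]
    push_cast; ring
  have hiff : ∀ r : Fin (n+1), JGood n (jrot r x) ↔
      ∀ t, t ≤ n → g r.val < g (r.val + (t+1)) := by
    intro r
    rw [jgood_rot_iff]
    apply forall_congr'; intro t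
    apply imp_congr_right; intro _
    simp only [g]
    push_cast
    omega
  -- existence
  obtain ⟨r, -, hr⟩ := Finset.exists_min_image (Finset.univ : Finset (Fin (n+1)))
    (fun r => toLex (g r.val, -(r.val : ℤ))) ⟨0, Finset.mem_univ _⟩
  have hr1 : ∀ q : ℕ, q ≤ n → g r.val ≤ g q ∧ (r.val < q → g r.val < g q) := by
    intro q hq
    have := hr ⟨q, by omega⟩ (Finset.mem_univ _)
    rw [Prod.Lex.le_iff] at this
    simp only [ofLex_toLex] at this
    omega
  refine ⟨r, ?_, ?_⟩
  · simp only
    rw [hiff]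
    intro t ht
    by_cases h : r.val + (t+1) ≤ n
    · exact (hr1 _ h).2 (by omega)
    · have h2 := (hr1 (r.val + (t+1) - (n+1)) (by omega)).1
      have h3 := hper (r.val + (t+1) - (n+1))
      rw [Nat.sub_add_cancel (by omega)] at h3
      omega
  · have key : ∀ a b : Fin (n+1), JGood n (jrot a x) → JGood n (jrot b x) → ¬ a < b := by
      intro a b ha hb hab
      rw [hiff] at ha hb
      have hab' : a.val < b.val := hab
      have h1 := ha (b.val - a.val - 1) (by omega)
      have h2 := hb (a.val + (n+1) - b.val - 1) (by omega)
      rw [show a.val + (b.val - a.val - 1 + 1) = b.val by omega] at h1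
      rw [show b.val + (a.val + (n+1) - b.val - 1 + 1) = a.val + (n+1) by omega, hper] at h2
      omega
    have hrg : JGood n (jrot r x) := by
      rw [hiff]
      intro t ht
      by_cases h : r.val + (t+1) ≤ n
      · exact (hr1 _ h).2 (by omega)
      · have h2 := (hr1 (r.val + (t+1) - (n+1)) (by omega)).1
        have h3 := hper (r.val + (t+1) - (n+1))
        rw [Nat.sub_add_cancel (by omega)] at h3
        omega
    intro b hb
    rcases lt_trichotomy b r with h | h | h
    · exact absurd h (key _ _ hb hrg)
    · exact h
    · exact absurd h (key _ _ hrg hb)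

open Classical in
lemma jcycle_lemma {n : ℕ} (S : Finset (Fin (n+1) → ℕ))
    (hS : ∀ x ∈ S, ∑ j, x j = n) (hrot : ∀ x ∈ S, ∀ r, jrot r x ∈ S) :
    (n+1) * (S.filter (JGood n)).card = S.card := by
  have h1 : ∀ r : Fin (n+1), (S.filter (fun x => JGood n (jrot r x))).card
      = (S.filter (JGood n)).card := by
    intro r
    apply Finset.card_nbij' (jrot r) (jrot (-r))
    · intro x hx
      simp only [Finset.coe_filter, Set.mem_ofPred_eq] at hx ⊢
      exact ⟨hrot x hx.1 r, hx.2⟩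
    · intro x hx
      simp only [Finset.coe_filter, Set.mem_ofPred_eq] at hx ⊢
      refine ⟨hrot x hx.1 _, ?_⟩
      have : jrot r (jrot (-r) x) = x := by
        funext j; simp [jrot]
      rw [this]; exact hx.2
    · intro x _; funext j; simp [jrot]
    · intro x _; funext j; simp [jrot]
  have h2 := Finset.sum_card_bipartiteAbove_eq_sum_card_bipartiteBelow
    (s := (Finset.univ : Finset (Fin (n+1)))) (t := S) (fun r x => JGood n (jrot r x))
  simp only [Finset.bipartiteAbove, Finset.bipartiteBelow, h1] at h2
  rw [Finset.sum_const, Finset.card_univ, Fintype.card_fin, smul_eq_mul] at h2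
  rw [h2, Finset.card_eq_sum_ones]
  apply Finset.sum_congr rfl
  intro x hx
  obtain ⟨r, hr, hu⟩ := jexists_unique_rot x (hS x hx)
  rw [Finset.card_eq_one]
  refine ⟨r, ?_⟩
  ext b
  simp only [Finset.mem_filter, Finset.mem_univ, true_and, Finset.mem_singleton]
  exact ⟨hu b, fun h => h ▸ hr⟩

/-- admissible functions: reversed running minima -/
def JT (n : ℕ) (T : Fin n → ℕ) : Prop :=
  Monotone T ∧ ∀ p, p.val + 1 ≤ T p ∧ T p ≤ n

/-- fibre counts -/
def jx {n : ℕ} (T : Fin n → ℕ) : Fin (n+1) → ℕ :=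
  fun t => (Finset.univ.filter (fun p => T p = t.val)).card

lemma jlower {n : ℕ} {T : Fin n → ℕ} (hT : Monotone T) (p : Fin n) (t : ℕ) :
    T p ≤ t ↔ p.val < (Finset.univ.filter (fun q => T q ≤ t)).card := by
  constructor
  · intro h
    have : Finset.Iic p ⊆ Finset.univ.filter (fun q => T q ≤ t) := by
      intro q hq
      simp only [Finset.mem_filter, Finset.mem_univ, true_and]
      exact (hT (Finset.mem_Iic.1 hq)).trans h
    have := Finset.card_le_card this
    rw [Fin.card_Iic] at this
    omega
  · intro h
    by_contra hc
    have : Finset.univ.filter (fun q => T q ≤ t) ⊆ Finset.Iio p := by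
      intro q hq
      simp only [Finset.mem_filter, Finset.mem_univ, true_and] at hq
      rw [Finset.mem_Iio]
      by_contra hpq
      exact hc ((hT (not_lt.1 hpq)).trans hq)
    have := Finset.card_le_card this
    rw [Fin.card_Iio] at this
    omega

lemma jY_jx {n : ℕ} (T : Fin n → ℕ) (t : ℕ) (ht : t ≤ n) :
    jY (jx T) (t+1) = (Finset.univ.filter (fun q => T q ≤ t)).card := by
  unfold jY jx
  rw [Finset.card_eq_sum_card_fiberwise (f := T) (t := Finset.range (t+1))]
  · apply Finset.sum_congr rfl
    intro s hs
    rw [Finset.mem_range] at hs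
    congr 1
    ext q
    have : s % (n+1) = s := Nat.mod_eq_of_lt (by omega)
    simp only [Finset.mem_filter, Finset.mem_univ, true_and, Fin.val_ofNat, this]
    omega
  · intro q hq
    simp only [Finset.coe_filter, Finset.mem_univ, true_and, Set.mem_ofPred_eq,
      Finset.coe_range, Set.mem_Iio] at hq ⊢
    omega

lemma jx_injOn {n : ℕ} {T T' : Fin n → ℕ} (hT : JT n T) (hT' : JT n T') (h : jx T = jx T') :
    T = T' := by
  have key : ∀ p t, t ≤ n → (T p ≤ t ↔ T' p ≤ t) := by
    intro p t ht
    rw [jlower hT.1, jlower hT'.1, ← jY_jx T t ht, ← jY_jx T' t ht, h]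
  funext p
  apply le_antisymm
  · exact (key p _ (hT'.2 p).2).2 le_rfl
  · exact (key p _ (hT.2 p).2).1 le_rfl

lemma jx_good {n : ℕ} {T : Fin n → ℕ} (hT : JT n T) :
    ∑ j, jx T j = n ∧ JGood n (jx T) := by
  constructor
  · rw [← jsum_range]
    have := jY_jx T n le_rfl
    unfold jY at this
    rw [this, Finset.filter_true_of_mem (fun q _ => (hT.2 q).2)]
    simp
  · intro t ht
    have := jY_jx T t ht
    unfold jY at this
    rw [this]
    have h2 : (Finset.univ.filter (fun q => T q ≤ t)).card ≤ (Finset.range t).card := by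
      apply Finset.card_le_card_of_injOn (fun q => q.val)
      · intro q hq
        simp only [Finset.coe_filter, Finset.mem_univ, true_and, Set.mem_ofPred_eq,
          Finset.coe_range, Set.mem_Iio] at hq ⊢
        have := (hT.2 q).1
        omega
      · intro a _ b _ hab
        exact Fin.ext hab
    simpa using h2

lemma jY_mono {n : ℕ} (x : Fin (n+1) → ℕ) : Monotone (jY x) := by
  intro a b hab
  unfold jY
  exact Finset.sum_le_sum_of_subset (Finset.range_mono hab)

lemma jx_surj {n : ℕ} (x : Fin (n+1) → ℕ) (hx : ∑ j, x j = n) (hg : JGood n x) :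
    ∃ T : Fin n → ℕ, JT n T ∧ jx T = x := by
  have hYn : jY x (n+1) = n := by unfold jY; rw [jsum_range, hx]
  let T : Fin n → ℕ := fun p => ((Finset.range (n+1)).filter (fun t => jY x (t+1) ≤ p.val)).card
  have key : ∀ p t, t ≤ n → (T p ≤ t ↔ p.val < jY x (t+1)) := by
    intro p t ht
    constructor
    · intro h
      by_contra hc
      have : Finset.range (t+1) ⊆ (Finset.range (n+1)).filter (fun t => jY x (t+1) ≤ p.val) := by
        intro s hs
        simp only [Finset.mem_range, Finset.mem_filter] at hs ⊢
        refine ⟨by omega, ?_⟩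
        have := jY_mono x (show s + 1 ≤ t + 1 by omega)
        omega
      have := Finset.card_le_card this
      rw [Finset.card_range] at this
      simp only [T] at h
      omega
    · intro h
      have : (Finset.range (n+1)).filter (fun t => jY x (t+1) ≤ p.val) ⊆ Finset.range t := by
        intro s hs
        simp only [Finset.mem_range, Finset.mem_filter] at hs ⊢
        by_contra hc
        have := jY_mono x (show t + 1 ≤ s + 1 by omega)
        omega
      have := Finset.card_le_card this
      rw [Finset.card_range] at this
      exact this
  have hTn : ∀ p, T p ≤ n := by
    intro p
    rw [key p n le_rfl, hYn]
    exact p.2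
  refine ⟨T, ⟨?_, ?_⟩, ?_⟩
  · intro p q hpq
    apply Finset.card_le_card
    intro s hs
    simp only [Finset.mem_range, Finset.mem_filter] at hs ⊢
    have : p.val ≤ q.val := hpq
    omega
  · intro p
    refine ⟨?_, hTn p⟩
    by_contra hc
    have h1 := (key p p.val (by omega)).1 (by omega)
    have h2 := hg p.val (by omega)
    unfold jY at h1
    omega
  · have hY : ∀ t, t ≤ n + 1 → jY (jx T) t = jY x t := by
      intro t ht
      rcases t with _ | t
      · simp [jY]
      · rw [jY_jx T t (by omega)]
        have h1 : jY x (t+1) ≤ n := by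
          have := jY_mono x ht
          omega
        rw [Finset.filter_congr (fun p _ => key p t (by omega))]
        have : (Finset.univ.filter (fun p : Fin n => p.val < jY x (t+1))).card = jY x (t+1) := by
          rw [Fin.card_filter_val_lt]
          omega
        exact this
    funext t
    have h1 := hY (t.val + 1) (by omega)
    have h0 := hY t.val (by omega)
    unfold jY at h1 h0
    rw [Finset.sum_range_succ, Finset.sum_range_succ, h0] at h1
    have : Fin.ofNat (n+1) t.val = t := by apply Fin.ext; simp
    rw [this] at h1
    omega

/-- words with prescribed statistics -/
def JStat {n : ℕ} (i k : ℕ) (x : Fin (n+1) → ℕ) : Prop :=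
  (∀ j, x j = 0 ∨ Odd (x j)) ∧
  (Finset.univ.filter (fun j => x j ≠ 0)).card = i ∧
  (Finset.univ.filter (fun j => 2 ≤ x j)).card = k

open Classical in
/-- all words with prescribed statistics and sum `n` -/
noncomputable def jS (n i k : ℕ) : Finset (Fin (n+1) → ℕ) :=
  (Finset.piAntidiag Finset.univ n).filter (JStat i k)

lemma mem_jS {n i k : ℕ} {x : Fin (n+1) → ℕ} :
    x ∈ jS n i k ↔ ∑ j, x j = n ∧ JStat i k x := by
  simp [jS]

lemma jcard_piAntidiag {ι : Type*} [DecidableEq ι] (s : Finset ι) (m : ℕ) :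
    (Finset.piAntidiag s m).card = s.card.multichoose m := by
  rw [← Finset.card_finsuppAntidiag_nat_eq_multichoose]
  symm
  apply Finset.card_nbij (fun f : ι →₀ ℕ => (f : ι → ℕ))
  · intro f hf
    simp only [Finset.mem_coe, Finset.mem_finsuppAntidiag, Finset.mem_piAntidiag] at hf ⊢
    refine ⟨hf.1, fun i hi => hf.2 ?_⟩
    simpa using hi
  · intro f _ g _ h
    exact DFunLike.coe_injective h
  · intro f hf
    simp only [Finset.mem_coe, Finset.mem_piAntidiag] at hf
    refine ⟨Finsupp.onFinset s f hf.2, ?_, rfl⟩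
    simp only [Finset.mem_coe, Finset.mem_finsuppAntidiag]
    refine ⟨hf.1, ?_⟩
    intro i hi
    apply hf.2
    simpa using hi

/-- building a word out of the data -/
def jbuild {n : ℕ} (a : (_ : Finset (Fin (n+1))) × (Finset (Fin (n+1)) × (Fin (n+1) → ℕ))) :
    Fin (n+1) → ℕ :=
  fun j => if j ∈ a.1 then 2 * a.2.2 j + 3 else if j ∈ a.2.1 then 1 else 0

/-- data of a word -/
def junbuild {n : ℕ} (x : Fin (n+1) → ℕ) :
    (_ : Finset (Fin (n+1))) × (Finset (Fin (n+1)) × (Fin (n+1) → ℕ)) :=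
  ⟨Finset.univ.filter (fun j => 2 ≤ x j),
    (Finset.univ.filter (fun j => x j = 1), fun j => (x j - 3) / 2)⟩

lemma jcard_jS {n i k : ℕ} (m : ℕ) (hki : k ≤ i) (hkm : k ≤ m) (hn : n = 2 * m + i) :
    (jS n i k).card = (n+1).choose k * ((n+1-k).choose (i-k) * k.multichoose (m-k)) := by
  have h : (jS n i k).card = ((Finset.powersetCard k (Finset.univ : Finset (Fin (n+1)))).sigma
      (fun K => Finset.powersetCard (i-k) Kᶜ ×ˢ Finset.piAntidiag K (m-k))).card := by
    apply Finset.card_nbij' junbuild jbuild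
    · intro x hx
      obtain ⟨hsum, hodd, hi, hk⟩ := mem_jS.1 hx
      have hsplit : (Finset.univ.filter (fun j => x j ≠ 0)).card =
          (Finset.univ.filter (fun j => 2 ≤ x j)).card +
            (Finset.univ.filter (fun j => x j = 1)).card := by
        rw [← Finset.card_union_of_disjoint]
        · congr 1; ext j; simp only [Finset.mem_filter, Finset.mem_univ, true_and,
            Finset.mem_union]; omega
        · rw [Finset.disjoint_filter]; intro j _; omega
      have hB : (Finset.univ.filter (fun j => x j = 1)).card = i - k := by omega
      simp only [junbuild, Finset.coe_sigma, Set.mem_sigma_iff, Finset.mem_coe,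
        Finset.mem_powersetCard, Finset.mem_product, Finset.mem_piAntidiag]
      refine ⟨⟨Finset.subset_univ _, hk⟩, ⟨?_, hB⟩, ?_, ?_⟩
      · intro j; simp only [Finset.mem_filter, Finset.mem_univ, true_and, Finset.mem_compl]; omega
      · have e : ∀ j, x j = (if 2 ≤ x j then 2 * ((x j - 3)/2) else 0) +
            ((if 2 ≤ x j then 3 else 0) + (if x j = 1 then 1 else 0)) := by
          intro j
          rcases hodd j with h | ⟨c, h⟩ <;> split_ifs <;> omega
        have e2 := Finset.sum_congr (rfl : (Finset.univ : Finset (Fin (n+1))) = Finset.univ)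
          (fun j _ => e j)
        rw [hsum, Finset.sum_add_distrib, Finset.sum_add_distrib, ← Finset.sum_filter,
          ← Finset.sum_filter, ← Finset.sum_filter, ← Finset.mul_sum, Finset.sum_const,
          Finset.sum_const, hk, hB] at e2
        simp only [smul_eq_mul] at e2
        omega
      · intro j hj
        simp only [Finset.mem_filter, Finset.mem_univ, true_and]
        omega
    · rintro ⟨K, B, c⟩ h
      simp only [Finset.coe_sigma, Set.mem_sigma_iff, Finset.mem_coe,
        Finset.mem_powersetCard, Finset.mem_product, Finset.mem_piAntidiag] at h
      obtain ⟨⟨-, hK⟩, ⟨hBK, hB⟩, hc, hcK⟩ := h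
      have hdis : Disjoint K B := by
        rw [Finset.disjoint_left]; intro j hj hj'
        exact absurd hj (Finset.mem_compl.1 (hBK hj'))
      simp only [Finset.mem_coe]
      rw [mem_jS]
      refine ⟨?_, ?_, ?_, ?_⟩
      · have e : ∀ j, jbuild ⟨K, B, c⟩ j = (if j ∈ K then 2 * c j + 3 else 0) +
            (if j ∈ B then 1 else 0) := by
          intro j
          have : j ∈ K → j ∉ B := fun h => Finset.disjoint_left.1 hdis h
          simp only [jbuild]
          split_ifs <;> simp_all
        simp only [e, Finset.sum_add_distrib, Finset.sum_ite_mem, Finset.univ_inter,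
          Finset.sum_const, ← Finset.mul_sum, hc, hK, hB, smul_eq_mul]
        omega
      · intro j
        simp only [jbuild]
        split_ifs
        · right; exact ⟨c j + 1, by ring⟩
        · right; exact odd_one
        · left; rfl
      · have : Finset.univ.filter (fun j => jbuild ⟨K, B, c⟩ j ≠ 0) = K ∪ B := by
          ext j
          simp only [jbuild, Finset.mem_filter, Finset.mem_univ, true_and, Finset.mem_union]
          split_ifs <;> simp_all
        rw [this, Finset.card_union_of_disjoint hdis]; omega
      · have : Finset.univ.filter (fun j => 2 ≤ jbuild ⟨K, B, c⟩ j) = K := by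
          ext j
          simp only [jbuild, Finset.mem_filter, Finset.mem_univ, true_and]
          split_ifs <;> simp_all
        rw [this]; omega
    · intro x hx
      obtain ⟨hsum, hodd, hi, hk⟩ := mem_jS.1 hx
      funext j
      simp only [jbuild, junbuild, Finset.mem_filter, Finset.mem_univ, true_and]
      rcases hodd j with h | ⟨c, h⟩ <;> split_ifs <;> omega
    · rintro ⟨K, B, c⟩ h
      simp only [Finset.coe_sigma, Set.mem_sigma_iff, Finset.mem_coe,
        Finset.mem_powersetCard, Finset.mem_product, Finset.mem_piAntidiag] at h
      obtain ⟨⟨-, hK⟩, ⟨hBK, hB⟩, hc, hcK⟩ := h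
      have hdis : Disjoint K B := by
        rw [Finset.disjoint_left]; intro j hj hj'
        exact absurd hj (Finset.mem_compl.1 (hBK hj'))
      have h1 : Finset.univ.filter (fun j => 2 ≤ jbuild ⟨K, B, c⟩ j) = K := by
        ext j
        simp only [jbuild, Finset.mem_filter, Finset.mem_univ, true_and]
        split_ifs <;> simp_all
      have h2 : Finset.univ.filter (fun j => jbuild ⟨K, B, c⟩ j = 1) = B := by
        ext j
        have : j ∈ K → j ∉ B := fun h => Finset.disjoint_left.1 hdis h
        simp only [jbuild, Finset.mem_filter, Finset.mem_univ, true_and]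
        split_ifs <;> simp_all
      have h3 : (fun j => (jbuild ⟨K, B, c⟩ j - 3) / 2) = c := by
        funext j
        simp only [jbuild]
        have := hcK j
        split_ifs with h h'
        · omega
        · have : c j = 0 := by by_contra h0; exact h (hcK j h0)
          omega
        · have : c j = 0 := by by_contra h0; exact h (hcK j h0)
          omega
      simp only [junbuild, h1, h2, h3]
  rw [h, Finset.card_sigma]
  rw [Finset.sum_congr rfl (g := fun _ => (n+1-k).choose (i-k) * k.multichoose (m-k))]
  · simp
  · intro K hK
    have hK := (Finset.mem_powersetCard.1 hK).2
    rw [Finset.card_product, Finset.card_powersetCard, jcard_piAntidiag, Finset.card_compl, hK,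
      Fintype.card_fin]

lemma jmultichoose {m k : ℕ} (hkm : k ≤ m) :
    ((k.multichoose (m-k) : ℕ) : ℤ) = chooseConv ((m : ℤ) - 1) ((k : ℤ) - 1) := by
  unfold chooseConv
  rcases k with _ | k
  · rcases m with _ | m
    · simp
    · simp
  · obtain ⟨d, rfl⟩ := Nat.exists_eq_add_of_le hkm
    rw [if_neg (by push_cast; omega), if_pos (by push_cast; omega)]
    rw [Nat.multichoose_eq]
    rw [show ((k + 1 + d : ℕ) : ℤ) - 1 = ((k + d : ℕ) : ℤ) by push_cast; ring,
      show ((k + 1 : ℕ) : ℤ) - 1 = (k : ℤ) by push_cast; ring, Int.toNat_natCast, Int.toNat_natCast]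
    rw [show k + 1 + d - (k+1) = d by omega, show k + 1 + d - 1 = k + d by omega]
    congr 1
    exact Nat.choose_symm_add.symm

/-- reversed running minimum of a permutation -/
def jT {n : ℕ} (π : Equiv.Perm (Fin n)) (p : Fin n) : ℕ :=
  (Finset.Iic p).sup (fun q => n - (π q).val)

lemma jT_le {n : ℕ} {π : Equiv.Perm (Fin n)} {p : Fin n} {t : ℕ} :
    jT π p ≤ t ↔ ∀ q, q ≤ p → n - (π q).val ≤ t := by
  simp [jT]

lemma le_jT {n : ℕ} (π : Equiv.Perm (Fin n)) {p q : Fin n} (h : q ≤ p) :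
    n - (π q).val ≤ jT π p := jT_le.1 le_rfl q h

lemma jT_attained {n : ℕ} (π : Equiv.Perm (Fin n)) (p : Fin n) :
    ∃ q, q ≤ p ∧ jT π p = n - (π q).val := by
  obtain ⟨q, hq, h⟩ := Finset.exists_mem_eq_sup (Finset.Iic p) ⟨p, by simp⟩
    (fun q => n - (π q).val)
  exact ⟨q, Finset.mem_Iic.1 hq, h⟩

lemma jT_mono {n : ℕ} (π : Equiv.Perm (Fin n)) : Monotone (jT π) := by
  intro p q h
  rw [jT_le]
  intro r hr
  exact le_jT π (hr.trans h)

lemma jT_JT {n : ℕ} (π : Equiv.Perm (Fin n)) : JT n (jT π) := by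
  refine ⟨jT_mono π, fun p => ⟨?_, ?_⟩⟩
  · have : (Finset.Iic p).card ≤ (Finset.range (jT π p)).card := by
      apply Finset.card_le_card_of_injOn (fun q => n - 1 - (π q).val)
      · intro q hq
        have h1 := le_jT π (Finset.mem_Iic.1 (Finset.mem_coe.1 hq))
        have h2 := (π q).2
        simp only [Finset.coe_range, Set.mem_Iio]
        omega
      · intro a _ b _ hab
        have h1 := (π a).2
        have h2 := (π b).2
        apply π.injective
        apply Fin.ext
        simp only at hab
        omega
    simpa using this
  · rw [jT_le]
    intro q _
    omega

/-- left-to-right minimum positions -/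
def JL {n : ℕ} (π : Equiv.Perm (Fin n)) (p : Fin n) : Prop := ∀ i : Fin n, i < p → π p < π i

lemma JL_T {n : ℕ} {π : Equiv.Perm (Fin n)} {p : Fin n} (h : JL π p) :
    jT π p = n - (π p).val := by
  apply le_antisymm
  · rw [jT_le]
    intro q hq
    rcases hq.eq_or_lt with rfl | hq
    · exact le_rfl
    · have : (π p).val < (π q).val := h q hq
      omega
  · exact le_jT π le_rfl

lemma JL_iff {n : ℕ} {π : Equiv.Perm (Fin n)} {p : Fin n} :
    JL π p ↔ ∀ q, q < p → jT π q < jT π p := by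
  constructor
  · intro h q hq
    rw [JL_T h]
    obtain ⟨r, hr, e⟩ := jT_attained π q
    have : (π p).val < (π r).val := h r (hr.trans_lt hq)
    have := (π r).2
    omega
  · intro h q hq
    obtain ⟨r, hr, e⟩ := jT_attained π p
    have hrp : r = p := by
      by_contra hne
      have h1 := h r (lt_of_le_of_ne hr hne)
      have h2 := le_jT π (le_refl r)
      omega
    subst hrp
    have h1 := h q hq
    have h2 := le_jT π (le_refl q)
    have h3 := (π r).2
    show (π r).val < (π q).val
    omega

lemma JL_not {n : ℕ} {π : Equiv.Perm (Fin n)} {p : Fin n} (h : ¬ JL π p) :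
    ∃ q, q < p ∧ π q < π p := by
  unfold JL at h
  push Not at h
  obtain ⟨q, hq, h⟩ := h
  exact ⟨q, hq, lt_of_le_of_ne h (fun e => hq.ne (π.injective e))⟩

lemma exists_first {n : ℕ} {T : Fin n → ℕ} (hT : Monotone T) (p : Fin n) :
    ∃ q, q ≤ p ∧ T q = T p ∧ ∀ r, r < q → T r < T q := by
  obtain ⟨q, hq, hmin⟩ := Finset.exists_min_image
    (Finset.univ.filter (fun q => T q = T p)) id ⟨p, by simp⟩
  simp only [Finset.mem_filter, Finset.mem_univ, true_and, id] at hq hmin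
  refine ⟨q, hmin p rfl, hq, ?_⟩
  intro r hr
  apply lt_of_le_of_ne (hT hr.le)
  intro e
  exact absurd (hmin r (e.trans hq)) (not_le.2 hr)

lemma rho_set {n : ℕ} {π : Equiv.Perm (Fin n)} {p : Fin n} (h : JL π p) (j : Fin n)
    (hj : p < j) : (∀ i : Fin n, p < i → i ≤ j → π p < π i) ↔ jT π j = jT π p := by
  constructor
  · intro H
    apply le_antisymm _ (jT_mono π hj.le)
    rw [jT_le]
    intro q hq
    rcases le_or_gt q p with hqp | hqp
    · exact le_jT π hqp
    · have : (π p).val < (π q).val := H q hqp hq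
      rw [JL_T h]
      omega
  · intro e i hi hij
    have h1 := le_jT π hij
    rw [e, JL_T h] at h1
    have h2 : π i ≠ π p := fun e => hi.ne' (π.injective e)
    have h3 : (π i).val ≠ (π p).val := fun e => h2 (Fin.ext e)
    have h4 := (π i).2
    show (π p).val < (π i).val
    omega

lemma jT_lt {n : ℕ} (π : Equiv.Perm (Fin n)) (p : Fin n) : jT π p < n + 1 := by
  have := ((jT_JT π).2 p).2
  omega

/-- `jT` as an element of `Fin (n+1)` -/
def jTF {n : ℕ} (π : Equiv.Perm (Fin n)) (p : Fin n) : Fin (n+1) := ⟨jT π p, jT_lt π p⟩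

lemma jx_eq_rho {n : ℕ} {π : Equiv.Perm (Fin n)} {p : Fin n} (h : JL π p) :
    jx (jT π) (jTF π p) = rhoLen π p + 1 := by
  classical
  unfold rhoLen
  rw [Nat.card_eq_fintype_card, Fintype.card_subtype]
  have : Finset.univ.filter (fun q => jT π q = jT π p) =
      insert p (Finset.univ.filter (fun j => p < j ∧ ∀ i : Fin n, p < i → i ≤ j → π p < π i)) := by
    ext j
    simp only [Finset.mem_filter, Finset.mem_univ, true_and, Finset.mem_insert]
    rcases lt_trichotomy j p with hj | rfl | hj
    · have := JL_iff.1 h j hj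
      constructor
      · intro e; omega
      · rintro (rfl | ⟨h1, -⟩)
        · rfl
        · exact absurd h1 hj.asymm
    · simp
    · rw [rho_set h j hj]
      simp [hj, hj.ne']
  show (Finset.univ.filter (fun q => jT π q = jT π p)).card = _
  rw [this, Finset.card_insert_of_notMem (by simp)]

lemma rho_zero {n : ℕ} {π : Equiv.Perm (Fin n)} (ha : Avoids123 π) {p : Fin n} (h : ¬ JL π p) :
    rhoLen π p = 0 := by
  unfold rhoLen
  rw [Nat.card_eq_zero]
  left
  constructor
  rintro ⟨j, hj, H⟩
  obtain ⟨q, hq, hqp⟩ := JL_not h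
  exact ha ⟨q, p, j, hq, hj, hqp, H j hj le_rfl⟩

lemma jx_ne_zero {n : ℕ} {π : Equiv.Perm (Fin n)} {t : Fin (n+1)} (h : jx (jT π) t ≠ 0) :
    ∃ p, JL π p ∧ jTF π p = t := by
  unfold jx at h
  rw [Finset.card_ne_zero] at h
  obtain ⟨p, hp⟩ := h
  simp only [Finset.mem_filter, Finset.mem_univ, true_and] at hp
  obtain ⟨q, -, hq, hf⟩ := exists_first (jT_mono π) p
  refine ⟨q, JL_iff.2 hf, ?_⟩
  apply Fin.ext
  show jT π q = t.val
  omega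

lemma jTF_inj {n : ℕ} {π : Equiv.Perm (Fin n)} {p q : Fin n} (hp : JL π p) (hq : JL π q)
    (h : jTF π p = jTF π q) : p = q := by
  have e : jT π p = jT π q := congrArg Fin.val h
  rcases lt_trichotomy p q with h1 | h1 | h1
  · have := JL_iff.1 hq p h1; omega
  · exact h1
  · have := JL_iff.1 hp q h1; omega

lemma jacobi_iff {n : ℕ} {π : Equiv.Perm (Fin n)} (ha : Avoids123 π) :
    IsJacobi π ↔ ∀ t, jx (jT π) t = 0 ∨ Odd (jx (jT π) t) := by
  constructor
  · intro h t
    by_cases h0 : jx (jT π) t = 0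
    · left; exact h0
    · right
      obtain ⟨p, hp, rfl⟩ := jx_ne_zero h0
      rw [jx_eq_rho hp]
      exact (h p).add_one
  · intro h p
    by_cases hp : JL π p
    · rcases h (jTF π p) with h1 | h1
      · rw [jx_eq_rho hp] at h1; omega
      · rw [jx_eq_rho hp] at h1
        rw [Nat.odd_add_one] at h1
        exact Nat.not_odd_iff_even.1 h1
    · rw [rho_zero ha hp]; exact Even.zero

lemma lrmin_eq {n : ℕ} (π : Equiv.Perm (Fin n)) :
    lrminCount π = (Finset.univ.filter (fun t => jx (jT π) t ≠ 0)).card := by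
  classical
  unfold lrminCount
  rw [Nat.card_eq_fintype_card, Fintype.card_subtype]
  apply Finset.card_nbij (jTF π)
  · intro p hp
    have hp : JL π p := by simpa [JL] using hp
    simp only [Finset.coe_filter, Finset.mem_univ, true_and, Set.mem_ofPred_eq]
    rw [jx_eq_rho hp]
    omega
  · intro p hp q hq h
    have hp : JL π p := by simpa [JL] using hp
    have hq : JL π q := by simpa [JL] using hq
    exact jTF_inj hp hq h
  · intro t ht
    simp only [Finset.coe_filter, Finset.mem_univ, true_and, Set.mem_ofPred_eq] at ht
    obtain ⟨p, hp, e⟩ := jx_ne_zero ht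
    refine ⟨p, ?_, e⟩
    simpa [JL] using hp

lemma asc_iff {n : ℕ} {π : Equiv.Perm (Fin n)} (ha : Avoids123 π) (p : Fin n) :
    (∃ h : (p : ℕ) + 1 < n, π p < π ⟨(p : ℕ) + 1, h⟩) ↔ JL π p ∧ 2 ≤ jx (jT π) (jTF π p) := by
  constructor
  · rintro ⟨h, hp⟩
    have hlt : p < ⟨(p : ℕ) + 1, h⟩ := by show p.val < p.val + 1; omega
    have hL : JL π p := by
      by_contra hL
      obtain ⟨q, hq, hqp⟩ := JL_not hL
      exact ha ⟨q, p, _, hq, hlt, hqp, hp⟩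
    refine ⟨hL, ?_⟩
    rw [jx_eq_rho hL]
    have : rhoLen π p ≠ 0 := by
      unfold rhoLen
      rw [Nat.card_ne_zero]
      refine ⟨⟨⟨⟨(p : ℕ) + 1, h⟩, hlt, ?_⟩⟩, inferInstance⟩
      intro i hi hi'
      have : i = ⟨(p : ℕ) + 1, h⟩ := by
        apply Fin.ext
        have h1 : p.val < i.val := hi
        have h2 : i.val ≤ p.val + 1 := hi'
        show i.val = p.val + 1
        omega
      rw [this]; exact hp
    omega
  · rintro ⟨hL, h⟩
    rw [jx_eq_rho hL] at h
    have : rhoLen π p ≠ 0 := by omega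
    unfold rhoLen at this
    rw [Nat.card_ne_zero] at this
    obtain ⟨⟨j, hj, H⟩⟩ := this.1
    have hj' : p.val < j.val := hj
    have hjn := j.2
    refine ⟨by omega, H _ ?_ ?_⟩
    · show p.val < p.val + 1; omega
    · show p.val + 1 ≤ j.val; omega

lemma asc_eq {n : ℕ} {π : Equiv.Perm (Fin n)} (ha : Avoids123 π) :
    ascCount π = (Finset.univ.filter (fun t => 2 ≤ jx (jT π) t)).card := by
  classical
  unfold ascCount
  simp only [asc_iff ha]
  rw [Nat.card_eq_fintype_card, Fintype.card_subtype]
  apply Finset.card_nbij (jTF π)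
  · intro p hp
    have hp : JL π p ∧ 2 ≤ jx (jT π) (jTF π p) := by simpa using hp
    simp only [Finset.coe_filter, Finset.mem_univ, true_and, Set.mem_ofPred_eq]
    exact hp.2
  · intro p hp q hq h
    have hp : JL π p ∧ 2 ≤ jx (jT π) (jTF π p) := by simpa using hp
    have hq : JL π q ∧ 2 ≤ jx (jT π) (jTF π q) := by simpa using hq
    exact jTF_inj hp.1 hq.1 h
  · intro t ht
    simp only [Finset.coe_filter, Finset.mem_univ, true_and, Set.mem_ofPred_eq] at ht
    obtain ⟨p, hp, e⟩ := jx_ne_zero (π := π) (t := t) (by omega)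
    refine ⟨p, ?_, e⟩
    subst e
    simpa using ⟨hp, ht⟩

lemma jT_injOn {n : ℕ} {π σ : Equiv.Perm (Fin n)} (ha : Avoids123 π) (hb : Avoids123 σ)
    (h : jT π = jT σ) : π = σ := by
  have hJ : ∀ p, JL π p ↔ JL σ p := by
    intro p
    rw [JL_iff, JL_iff, h]
  have heq : ∀ p, JL π p → π p = σ p := by
    intro p hp
    have h1 := JL_T hp
    have h2 := JL_T ((hJ p).1 hp)
    rw [h] at h1
    apply Fin.ext
    have := (π p).2
    have := (σ p).2
    omega
  have key : ∀ (π σ : Equiv.Perm (Fin n)), Avoids123 π → (∀ p, JL π p → π p = σ p) →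
      ∀ p, (∀ q, q < p → π q = σ q) → ¬ π p < σ p := by
    intro π σ ha heq p hq hlt
    have hp : ¬ JL π p := fun hp => hlt.ne (heq p hp)
    obtain ⟨q, e⟩ := π.surjective (σ p)
    rcases lt_trichotomy q p with h1 | h1 | h1
    · rw [hq q h1] at e
      exact h1.ne (σ.injective e)
    · rw [h1] at e; exact hlt.ne e
    · obtain ⟨r, hr, hrp⟩ := JL_not hp
      exact ha ⟨r, p, q, hr, h1, hrp, e ▸ hlt⟩
  apply Equiv.ext
  intro p
  induction p using WellFoundedLT.induction with
  | ind p ih =>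
    have h1 := key π σ ha heq p ih
    have h2 := key σ π hb (fun p hp => (heq p ((hJ p).2 hp)).symm) p (fun q hq => (ih q hq).symm)
    exact le_antisymm (not_lt.1 h2) (not_lt.1 h1)

lemma exists_perm {n : ℕ} {T : Fin n → ℕ} (hT : JT n T) :
    ∃ π : Equiv.Perm (Fin n), (∀ p, (∀ q, q < p → T q < T p) → (π p).val + T p = n) ∧
      (∀ p q, p < q → (¬ ∀ r, r < p → T r < T p) → (¬ ∀ r, r < q → T r < T q) → π q < π p) := by
  classical
  let M : Fin n → Fin n := fun p => ⟨n - T p, by have := (hT.2 p).1; have := p.2; omega⟩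
  let P : Finset (Fin n) := Finset.univ.filter (fun p => ¬ ∀ r, r < p → T r < T p)
  let R : Finset (Fin n) := Finset.univ.image M
  have hMinj : ∀ p q, p ∉ P → q ∉ P → M p = M q → p = q := by
    intro p q hp hq e
    simp only [P, Finset.mem_filter, Finset.mem_univ, true_and, not_not] at hp hq
    have e' : n - T p = n - T q := congrArg Fin.val e
    have h1 := (hT.2 p).2
    have h2 := (hT.2 q).2
    rcases lt_trichotomy p q with h | h | h
    · have := hq p h; omega
    · exact h
    · have := hp q h; omega
  have hR : R = Pᶜ.image M := by
    ext v
    simp only [R, Finset.mem_image, Finset.mem_univ, true_and, Finset.mem_compl]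
    constructor
    · rintro ⟨p, rfl⟩
      obtain ⟨q, -, e, hq⟩ := exists_first hT.1 p
      refine ⟨q, ?_, ?_⟩
      · simp only [P, Finset.mem_filter, Finset.mem_univ, true_and, not_not]; exact hq
      · apply Fin.ext; show n - T q = n - T p; rw [e]
    · rintro ⟨p, -, rfl⟩; exact ⟨p, rfl⟩
  have hcard : Rᶜ.card = P.card := by
    have h1 : R.card = Pᶜ.card := by
      rw [hR]
      apply Finset.card_image_of_injOn
      intro p hp q hq e
      exact hMinj p q (by simpa using hp) (by simpa using hq) e
    have h2 := Finset.card_add_card_compl R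
    have h3 := Finset.card_add_card_compl P
    omega
  let f : Fin n → Fin n := fun p =>
    if h : p ∈ P then Rᶜ.orderEmbOfFin hcard (Fin.rev ((P.orderIsoOfFin rfl).symm ⟨p, h⟩)) else M p
  have fP : ∀ p, p ∈ P → f p ∈ Rᶜ := by
    intro p hp
    simp only [f, dif_pos hp]
    exact Finset.orderEmbOfFin_mem _ _ _
  have fnP : ∀ p, p ∉ P → f p = M p := by
    intro p hp
    simp only [f, dif_neg hp]
  have fdec : ∀ p q, p ∈ P → q ∈ P → p < q → f q < f p := by
    intro p q hp hq h
    simp only [f, dif_pos hp, dif_pos hq]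
    rw [OrderEmbedding.lt_iff_lt, Fin.rev_lt_rev, OrderIso.lt_iff_lt]
    exact h
  have finj : Function.Injective f := by
    intro p q e
    by_cases hp : p ∈ P <;> by_cases hq : q ∈ P
    · rcases lt_trichotomy p q with h | h | h
      · exact absurd e (fdec p q hp hq h).ne'
      · exact h
      · exact absurd e (fdec q p hq hp h).ne
    · have h1 := fP p hp
      rw [e, fnP q hq] at h1
      simp [R] at h1
    · have h1 := fP q hq
      rw [← e, fnP p hp] at h1
      simp [R] at h1
    · rw [fnP p hp, fnP q hq] at e
      exact hMinj p q hp hq e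
  refine ⟨Equiv.ofBijective f (Finite.injective_iff_bijective.1 finj), ?_, ?_⟩
  · intro p hp
    have hp' : p ∉ P := by
      simp only [P, Finset.mem_filter, Finset.mem_univ, true_and, not_not]; exact hp
    rw [Equiv.ofBijective_apply, fnP p hp']
    show n - T p + T p = n
    have := (hT.2 p).2
    omega
  · intro p q hpq hp hq
    rw [Equiv.ofBijective_apply, Equiv.ofBijective_apply]
    apply fdec p q _ _ hpq
    · simp only [P, Finset.mem_filter, Finset.mem_univ, true_and]; exact hp
    · simp only [P, Finset.mem_filter, Finset.mem_univ, true_and]; exact hq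

lemma jT_surj {n : ℕ} {T : Fin n → ℕ} (hT : JT n T) :
    ∃ π : Equiv.Perm (Fin n), Avoids123 π ∧ jT π = T := by
  obtain ⟨π, h1, h2⟩ := exists_perm hT
  have hge : ∀ p, n ≤ (π p).val + T p := by
    intro p
    by_cases hp : ∀ r, r < p → T r < T p
    · exact (h1 p hp).ge
    · by_contra hlt
      have hsub : (Finset.univ.filter (fun v : Fin n => n ≤ v.val + T p)).card ≤
          (Finset.Iio p).card := by
        apply Finset.card_le_card_of_injOn π.symm
        · intro v hv
          simp only [Finset.coe_filter, Finset.mem_univ, true_and, Set.mem_ofPred_eq] at hv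
          simp only [Finset.coe_Iio, Set.mem_Iio]
          obtain ⟨q, rfl⟩ := π.surjective v
          rw [Equiv.symm_apply_apply]
          by_contra hqp
          rcases (not_lt.1 hqp).eq_or_lt with rfl | hpq
          · omega
          · by_cases hq : ∀ r, r < q → T r < T q
            · have h3 := h1 q hq
              have h4 := hq p hpq
              omega
            · have h3 : (π q).val < (π p).val := h2 p q hpq hp hq
              omega
        · exact π.symm.injective.injOn
      have hc : p.val + 1 ≤ (Finset.univ.filter (fun v : Fin n => n ≤ v.val + T p)).card := by
        have h5 := (hT.2 p).1
        have h6 : (Finset.Iic p).card ≤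
            (Finset.univ.filter (fun v : Fin n => n ≤ v.val + T p)).card := by
          apply Finset.card_le_card_of_injOn Fin.rev
          · intro v hv
            have hv : v ≤ p := by simpa using hv
            have hv : v.val ≤ p.val := hv
            simp only [Finset.coe_filter, Finset.mem_univ, true_and, Set.mem_ofPred_eq,
              Fin.val_rev]
            omega
          · exact Fin.rev_injective.injOn
        rwa [Fin.card_Iic] at h6
      rw [Fin.card_Iio] at hsub
      omega
  refine ⟨π, ?_, ?_⟩
  · rintro ⟨i, j, k, hij, hjk, hπ, hπ'⟩
    have aux : ∀ i j, i < j → π i < π j → ¬ ∀ r, r < j → T r < T j := by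
      intro i j hij hπ hj
      have h3 := h1 j hj
      have h4 := hge i
      have h5 := hj i hij
      have h6 : (π i).val < (π j).val := hπ
      omega
    exact (h2 j k hjk (aux i j hij hπ) (aux j k hjk hπ')).asymm hπ'
  · funext p
    apply le_antisymm
    · rw [jT_le]
      intro q hq
      have h3 := hge q
      have h4 := hT.1 hq
      omega
    · obtain ⟨q, hq, e, hf⟩ := exists_first hT.1 p
      have h3 := h1 q hf
      have h4 := le_jT π hq
      omega

lemma jcount (n i k : ℕ) :
    Nat.card {π : Equiv.Perm (Fin n) //
      IsJacobi π ∧ Avoids123 π ∧ lrminCount π = i ∧ ascCount π = k} =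
    Nat.card {x : Fin (n+1) → ℕ // x ∈ jS n i k ∧ JGood n x} := by
  apply Nat.card_eq_of_bijective (fun π => ⟨jx (jT π.1), by
    obtain ⟨π, h1, h2, h3, h4⟩ := π
    have hg := jx_good (jT_JT π)
    refine ⟨mem_jS.2 ⟨hg.1, (jacobi_iff h2).1 h1, ?_, ?_⟩, hg.2⟩
    · rw [← lrmin_eq]; exact h3
    · rw [← asc_eq h2]; exact h4⟩)
  constructor
  · rintro ⟨π, h1, h2, h3, h4⟩ ⟨σ, g1, g2, g3, g4⟩ e
    simp only [Subtype.mk.injEq] at e ⊢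
    exact jT_injOn h2 g2 (jx_injOn (jT_JT π) (jT_JT σ) e)
  · rintro ⟨x, hx, hg⟩
    obtain ⟨hs, hst⟩ := mem_jS.1 hx
    obtain ⟨T, hT, rfl⟩ := jx_surj x hs hg
    obtain ⟨π, ha, rfl⟩ := jT_surj hT
    refine ⟨⟨π, (jacobi_iff ha).2 hst.1, ha, ?_, ?_⟩, rfl⟩
    · rw [lrmin_eq]; exact hst.2.1
    · rw [asc_eq ha]; exact hst.2.2

lemma jS_rot {n i k : ℕ} (x : Fin (n+1) → ℕ) (hx : x ∈ jS n i k) (r : Fin (n+1)) :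
    jrot r x ∈ jS n i k := by
  rw [mem_jS] at hx ⊢
  obtain ⟨h1, h2, h3, h4⟩ := hx
  have hc : ∀ Q : ℕ → Prop, ∀ [DecidablePred Q],
      (Finset.univ.filter (fun j => Q (jrot r x j))).card =
      (Finset.univ.filter (fun j => Q (x j))).card := by
    intro Q _
    apply Finset.card_bij (fun j _ => j + r)
    · intro j hj
      exact Finset.mem_filter.2 ⟨Finset.mem_univ _, (Finset.mem_filter.1 hj).2⟩
    · intro a _ b _ h; simpa using h
    · intro b hb
      refine ⟨b - r, Finset.mem_filter.2 ⟨Finset.mem_univ _, ?_⟩, by simp⟩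
      simp only [jrot, sub_add_cancel]
      exact (Finset.mem_filter.1 hb).2
  refine ⟨?_, fun j => h2 _, ?_, ?_⟩
  · exact (Equiv.sum_comp (Equiv.addRight r) x).trans h1
  · rw [← h3]; exact hc (fun a => a ≠ 0)
  · rw [← h4]; exact hc (fun a => 2 ≤ a)

lemma jS_parity {n i k : ℕ} (x : Fin (n+1) → ℕ) (hx : x ∈ jS n i k) : n % 2 = i % 2 := by
  obtain ⟨h1, h2, h3, h4⟩ := mem_jS.1 hx
  have e : ∀ j, x j = 2 * (x j / 2) + (if x j ≠ 0 then 1 else 0) := by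
    intro j
    rcases h2 j with h | ⟨c, h⟩ <;> split_ifs <;> omega
  have e2 := Finset.sum_congr (rfl : (Finset.univ : Finset (Fin (n+1))) = Finset.univ)
    (fun j _ => e j)
  rw [h1, Finset.sum_add_distrib, ← Finset.sum_filter, ← Finset.mul_sum, Finset.sum_const, h3] at e2
  simp only [smul_eq_mul] at e2
  omega

/-- Joint distribution of left-to-right minima and ascents over 123-avoiding Jacobi
permutations of `[n]`. -/
theorem jacobi_avoid_123_lrmin_asc (n i k : ℕ) (hki : k ≤ i) (hin : i ≤ n)
    (hk : 2 * k ≤ n - i) :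
    (n % 2 = i % 2 →
      (Nat.card {π : Equiv.Perm (Fin n) //
          IsJacobi π ∧ Avoids123 π ∧ lrminCount π = i ∧ ascCount π = k} : ℚ)
        = (1 / ((n : ℚ) + 1)) * ((n + 1).choose k : ℕ) * ((n + 1 - k).choose (i - k) : ℕ)
            * (chooseConv ((((n - i) / 2 : ℕ) : ℤ) - 1) ((k : ℤ) - 1) : ℤ)) ∧
    (n % 2 ≠ i % 2 →
      Nat.card {π : Equiv.Perm (Fin n) //
          IsJacobi π ∧ Avoids123 π ∧ lrminCount π = i ∧ ascCount π = k} = 0) := by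
  rw [jcount]
  constructor
  · intro hpar
    classical
    obtain ⟨m, hm⟩ : ∃ m, n = 2 * m + i := ⟨(n - i) / 2, by omega⟩
    have hkm : k ≤ m := by omega
    have hc : (n+1) * ((jS n i k).filter (JGood n)).card = (jS n i k).card :=
      jcycle_lemma (jS n i k) (fun x hx => (mem_jS.1 hx).1) jS_rot
    rw [jcard_jS m hki hkm hm] at hc
    have h1 : Nat.card {x : Fin (n+1) → ℕ // x ∈ jS n i k ∧ JGood n x} =
        ((jS n i k).filter (JGood n)).card := by
      rw [← Nat.card_eq_finsetCard]
      exact Nat.card_congr (Equiv.subtypeEquivRight (by intro x; simp))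
    rw [h1, show (n - i) / 2 = m by omega, ← jmultichoose hkm]
    have hc' : ((n : ℚ) + 1) * (((jS n i k).filter (JGood n)).card : ℚ) =
        ((n+1).choose k : ℕ) * (((n+1-k).choose (i-k) : ℕ) * (k.multichoose (m-k) : ℕ)) := by
      exact_mod_cast hc
    have hn : (n : ℚ) + 1 ≠ 0 := by positivity
    rw [Int.cast_natCast]
    field_simp
    linarith [hc']
  · intro hpar
    rw [Nat.card_eq_zero]
    left
    constructor
    rintro ⟨x, hx, -⟩
    exact hpar (jS_parity x hx)
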